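/- Let t, a, b, p, q ∈ ℝ satisfy 2t²(a² + b² + p² + q²) < 1 and let L_t be the block-diagonal 4×4 matrix with blocks [[ta, tb],[tb, -ta]] and [[tp, tq],[tq, -tp]]. Then I + L_t is invertible and the matrix J_t := (I + L_t) J₀ (I + L_t)⁻¹ is the block-diagonal matrix with first block (1/(t²(a²+b²) - 1)) · [[-2tb, (ta+1)² + t²b²],[-((ta-1)² + t²b²), 2tb]] and second block (1/(t²(p²+q²) - 1)) · [[-2tq, (tp+1)² + t²q²],[-((tp-1)² + t²q²), 2tq]]. Moreover J_t² = -I and J_t is calibrated by ω: ω(J_t u, J_t v) = ω(u,v) for all u, v ∈ ℝ⁴ and ω(v, J_t v) > 0 for every nonzero v ∈ ℝ⁴. -/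

import Mathlib

/- STATEMENT 17: Let `t, a, b, p, q ∈ ℝ` with `2 t² (a² + b² + p² + q²) < 1` and let `L_t` be
the block-diagonal matrix with blocks `[[ta, tb],[tb, -ta]]` and `[[tp, tq],[tq, -tp]]`.
Then `I + L_t` is invertible, `J_t := (I + L_t) J₀ (I + L_t)⁻¹` is the block-diagonal matrix
with first block `(1/(t²(a²+b²) - 1)) [[-2tb, (ta+1)² + t²b²],[-((ta-1)² + t²b²), 2tb]]` and
second block `(1/(t²(p²+q²) - 1)) [[-2tq, (tp+1)² + t²q²],[-((tp-1)² + t²q²), 2tq]]`.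
Moreover `J_t² = -I` and `J_t` is calibrated by `ω = e¹² + e³⁴`. -/

open Matrix

/-- The standard complex structure `J₀` on `ℝ⁴` with `J₀ e₁ = e₂`, `J₀ e₃ = e₄`. -/
noncomputable def J4 : Matrix (Fin 4) (Fin 4) ℝ :=
  !![0, -1, 0, 0; 1, 0, 0, 0; 0, 0, 0, -1; 0, 0, 1, 0]

/-- The symplectic form `ω(u, v) = g(J₀ u, v)`, i.e. `ω = e¹² + e³⁴`. -/
noncomputable def omega4 (u v : Fin 4 → ℝ) : ℝ :=
  (J4 *ᵥ u) ⬝ᵥ v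

/-- The block-diagonal deformation matrix `L_t` with blocks `[[ta, tb],[tb, -ta]]` and
`[[tp, tq],[tq, -tp]]`. -/
noncomputable def Lt (t a b p q : ℝ) : Matrix (Fin 4) (Fin 4) ℝ :=
  !![t * a, t * b, 0, 0;
     t * b, -(t * a), 0, 0;
     0, 0, t * p, t * q;
     0, 0, t * q, -(t * p)]

/-- The quadratic form `ω(v, J v)` of a single `2 × 2` block, up to the positive factor
`(1 - x² - y²)⁻¹`, is nonnegative. -/
lemma blockForm_nonneg (x y v w : ℝ) :
    0 ≤ ((x - 1) ^ 2 + y ^ 2) * v ^ 2 - 4 * y * v * w + ((x + 1) ^ 2 + y ^ 2) * w ^ 2 := by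
  nlinarith [sq_nonneg ((1 - x) * v - y * w), sq_nonneg (y * v - (1 + x) * w)]

/-- The quadratic form of a block vanishes only at the origin. -/
lemma eq_zero_of_blockForm_eq_zero {x y v w : ℝ} (hd : x ^ 2 + y ^ 2 < 1)
    (h : ((x - 1) ^ 2 + y ^ 2) * v ^ 2 - 4 * y * v * w + ((x + 1) ^ 2 + y ^ 2) * w ^ 2 = 0) :
    v = 0 ∧ w = 0 := by
  have h₁ : (1 - x) * v - y * w = 0 := by
    nlinarith [sq_nonneg ((1 - x) * v - y * w), sq_nonneg (y * v - (1 + x) * w)]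
  have h₂ : y * v - (1 + x) * w = 0 := by
    nlinarith [sq_nonneg ((1 - x) * v - y * w), sq_nonneg (y * v - (1 + x) * w)]
  have hd' : 1 - x ^ 2 - y ^ 2 ≠ 0 := by linarith
  refine ⟨?_, ?_⟩ <;> apply (mul_eq_zero.mp _).resolve_left hd'
  · linear_combination (1 + x) * h₁ - y * h₂
  · linear_combination y * h₁ - (1 - x) * h₂

lemma det_one_add_Lt (t a b p q : ℝ) :
    (1 + Lt t a b p q).det =
      (1 - t ^ 2 * (a ^ 2 + b ^ 2)) * (1 - t ^ 2 * (p ^ 2 + q ^ 2)) := by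
  simp [Lt, Matrix.det_succ_row_zero, Fin.sum_univ_succ, Fin.succAbove, Matrix.one_apply]
  ring

/-- Explicit form of the conjugate of `J₀` by `1 + L_t`. -/
lemma conj_J4_eq {t a b p q : ℝ} (hA : t ^ 2 * (a ^ 2 + b ^ 2) - 1 ≠ 0)
    (hP : t ^ 2 * (p ^ 2 + q ^ 2) - 1 ≠ 0) (hdet : IsUnit (1 + Lt t a b p q).det) :
    (1 + Lt t a b p q) * J4 * (1 + Lt t a b p q)⁻¹ =
      !![(1 / (t ^ 2 * (a ^ 2 + b ^ 2) - 1)) * (-2 * t * b),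
         (1 / (t ^ 2 * (a ^ 2 + b ^ 2) - 1)) * ((t * a + 1) ^ 2 + t ^ 2 * b ^ 2), 0, 0;
         (1 / (t ^ 2 * (a ^ 2 + b ^ 2) - 1)) * (-((t * a - 1) ^ 2 + t ^ 2 * b ^ 2)),
         (1 / (t ^ 2 * (a ^ 2 + b ^ 2) - 1)) * (2 * t * b), 0, 0;
         0, 0, (1 / (t ^ 2 * (p ^ 2 + q ^ 2) - 1)) * (-2 * t * q),
         (1 / (t ^ 2 * (p ^ 2 + q ^ 2) - 1)) * ((t * p + 1) ^ 2 + t ^ 2 * q ^ 2);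
         0, 0, (1 / (t ^ 2 * (p ^ 2 + q ^ 2) - 1)) * (-((t * p - 1) ^ 2 + t ^ 2 * q ^ 2)),
         (1 / (t ^ 2 * (p ^ 2 + q ^ 2) - 1)) * (2 * t * q)] := by
  have := Matrix.invertibleOfIsUnitDet _ hdet
  rw [Matrix.mul_inv_eq_iff_eq_mul_of_invertible]
  ext i j
  fin_cases i <;> fin_cases j <;>
    simp [J4, Lt, Matrix.mul_apply, Fin.sum_univ_four, Matrix.one_apply] <;> field_simp <;> ring

theorem statement17 (t a b p q : ℝ) (h : 2 * t ^ 2 * (a ^ 2 + b ^ 2 + p ^ 2 + q ^ 2) < 1) :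
    IsUnit (1 + Lt t a b p q) ∧
    (1 + Lt t a b p q) * J4 * (1 + Lt t a b p q)⁻¹ =
      !![(1 / (t ^ 2 * (a ^ 2 + b ^ 2) - 1)) * (-2 * t * b),
         (1 / (t ^ 2 * (a ^ 2 + b ^ 2) - 1)) * ((t * a + 1) ^ 2 + t ^ 2 * b ^ 2), 0, 0;
         (1 / (t ^ 2 * (a ^ 2 + b ^ 2) - 1)) * (-((t * a - 1) ^ 2 + t ^ 2 * b ^ 2)),
         (1 / (t ^ 2 * (a ^ 2 + b ^ 2) - 1)) * (2 * t * b), 0, 0;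
         0, 0, (1 / (t ^ 2 * (p ^ 2 + q ^ 2) - 1)) * (-2 * t * q),
         (1 / (t ^ 2 * (p ^ 2 + q ^ 2) - 1)) * ((t * p + 1) ^ 2 + t ^ 2 * q ^ 2);
         0, 0, (1 / (t ^ 2 * (p ^ 2 + q ^ 2) - 1)) * (-((t * p - 1) ^ 2 + t ^ 2 * q ^ 2)),
         (1 / (t ^ 2 * (p ^ 2 + q ^ 2) - 1)) * (2 * t * q)] ∧
    ((1 + Lt t a b p q) * J4 * (1 + Lt t a b p q)⁻¹) *
      ((1 + Lt t a b p q) * J4 * (1 + Lt t a b p q)⁻¹) = -1 ∧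
    (∀ u v : Fin 4 → ℝ,
      omega4 (((1 + Lt t a b p q) * J4 * (1 + Lt t a b p q)⁻¹) *ᵥ u)
          (((1 + Lt t a b p q) * J4 * (1 + Lt t a b p q)⁻¹) *ᵥ v) =
        omega4 u v) ∧
    (∀ v : Fin 4 → ℝ, v ≠ 0 →
      0 < omega4 v (((1 + Lt t a b p q) * J4 * (1 + Lt t a b p q)⁻¹) *ᵥ v)) := by
  have hA : t ^ 2 * (a ^ 2 + b ^ 2) < 1 := by
    nlinarith [mul_nonneg (sq_nonneg t) (add_nonneg (sq_nonneg a) (sq_nonneg b)),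
      mul_nonneg (sq_nonneg t) (add_nonneg (sq_nonneg p) (sq_nonneg q))]
  have hP : t ^ 2 * (p ^ 2 + q ^ 2) < 1 := by
    nlinarith [mul_nonneg (sq_nonneg t) (add_nonneg (sq_nonneg a) (sq_nonneg b)),
      mul_nonneg (sq_nonneg t) (add_nonneg (sq_nonneg p) (sq_nonneg q))]
  have hA0 : t ^ 2 * (a ^ 2 + b ^ 2) - 1 ≠ 0 := by linarith
  have hP0 : t ^ 2 * (p ^ 2 + q ^ 2) - 1 ≠ 0 := by linarith
  have hdet : IsUnit (1 + Lt t a b p q).det := by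
    rw [det_one_add_Lt, isUnit_iff_ne_zero]
    exact (mul_pos (by linarith) (by linarith)).ne'
  have hJ2 : J4 * J4 = -1 := by
    ext i j
    fin_cases i <;> fin_cases j <;> simp [J4, Matrix.mul_apply, Fin.sum_univ_four]
  have hM := conj_J4_eq hA0 hP0 hdet
  refine ⟨(Matrix.isUnit_iff_isUnit_det _).2 hdet, hM, ?_, ?_, ?_⟩
  · rw [show ∀ S T : Matrix (Fin 4) (Fin 4) ℝ, S * J4 * T * (S * J4 * T) =
        S * J4 * (T * S) * J4 * T from fun S T => by simp only [Matrix.mul_assoc],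
      Matrix.nonsing_inv_mul _ hdet, Matrix.mul_one, Matrix.mul_assoc _ J4 J4, hJ2,
      Matrix.mul_neg, Matrix.mul_one, Matrix.neg_mul, Matrix.mul_nonsing_inv _ hdet]
  · intro u v
    rw [hM]
    simp only [omega4, J4, Matrix.mulVec, dotProduct, Fin.sum_univ_four]
    simp
    field_simp
    ring
  · intro v hv
    rw [hM]
    set F := ((t * a - 1) ^ 2 + (t * b) ^ 2) * v 0 ^ 2 - 4 * (t * b) * v 0 * v 1 +
      ((t * a + 1) ^ 2 + (t * b) ^ 2) * v 1 ^ 2 with hF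
    set G := ((t * p - 1) ^ 2 + (t * q) ^ 2) * v 2 ^ 2 - 4 * (t * q) * v 2 * v 3 +
      ((t * p + 1) ^ 2 + (t * q) ^ 2) * v 3 ^ 2 with hG
    have hF0 : 0 ≤ F := blockForm_nonneg _ _ _ _
    have hG0 : 0 ≤ G := blockForm_nonneg _ _ _ _
    have hdA : 0 < 1 - t ^ 2 * (a ^ 2 + b ^ 2) := by linarith
    have hdP : 0 < 1 - t ^ 2 * (p ^ 2 + q ^ 2) := by linarith
    have key : ∀ M, M = F / (1 - t ^ 2 * (a ^ 2 + b ^ 2)) + G / (1 - t ^ 2 * (p ^ 2 + q ^ 2)) →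
        0 < M := by
      rintro _ rfl
      rcases hF0.lt_or_eq with hlt | hF1
      · exact add_pos_of_pos_of_nonneg (div_pos hlt hdA) (div_nonneg hG0 hdP.le)
      rcases hG0.lt_or_eq with hlt | hG1
      · exact add_pos_of_nonneg_of_pos (div_nonneg hF0 hdA.le) (div_pos hlt hdP)
      obtain ⟨h0, h1⟩ := eq_zero_of_blockForm_eq_zero (by linarith) hF1.symm
      obtain ⟨h2, h3⟩ := eq_zero_of_blockForm_eq_zero (by linarith) hG1.symm
      refine absurd (funext fun i => ?_) hv
      fin_cases i <;> assumption
    apply key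
    rw [← neg_sub (t ^ 2 * (a ^ 2 + b ^ 2)) 1, ← neg_sub (t ^ 2 * (p ^ 2 + q ^ 2)) 1,
      div_neg, div_neg, div_eq_mul_one_div F, div_eq_mul_one_div G, hF, hG]
    simp only [omega4, J4, Matrix.mulVec, dotProduct, Fin.sum_univ_four]
    simp
    ring
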